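/- Let A ⊆ ℝ. If ACω(A) holds, then A is separable, i.e., there is a countable subset of A that is dense in A (with respect to the subspace topology inherited from ℝ). -/

import Mathlib

/-- `ACω X`: Countable Choice for the set `X`. -/
def AComega {α : Type*} (X : Set α) : Prop :=
  ∀ A : ℕ → Set α, (∀ n, A n ⊆ X) → (∀ n, (A n).Nonempty) →
    ∃ a : ℕ → α, ∀ n, a n ∈ A n

/-- If `A ⊆ ℝ` and `ACω(A)` holds, then `A` is separable: there is a countable
subset of `A` that is dense in `A` (for the subspace topology, i.e. `A ⊆ closure D`). -/
theorem separable_of_acomega (A : Set ℝ) (h : AComega A) :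
    ∃ D ⊆ A, D.Countable ∧ A ⊆ closure D := by
  rcases A.eq_empty_or_nonempty with rfl | hA
  · exact ⟨∅, Set.empty_subset _, Set.countable_empty, Set.empty_subset _⟩
  obtain ⟨e, he⟩ := exists_surjective_nat (ℚ × ℚ)
  let I : ℕ → Set ℝ := fun n => Set.Ioo ((e n).1 : ℝ) ((e n).2 : ℝ)
  -- Sets `I n` missing `A` are replaced by `A` itself, so that every set in the family is nonempty.
  obtain ⟨a, ha⟩ := h (fun n => {x ∈ A | (A ∩ I n).Nonempty → x ∈ I n})
    (fun n x hx => hx.1) (fun n => by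
      by_cases hn : (A ∩ I n).Nonempty
      · obtain ⟨x, hxA, hxI⟩ := hn
        exact ⟨x, hxA, fun _ => hxI⟩
      · obtain ⟨x, hx⟩ := hA
        exact ⟨x, hx, fun hn' => absurd hn' hn⟩)
  refine ⟨Set.range a, Set.range_subset_iff.2 fun n => (ha n).1, Set.countable_range a, ?_⟩
  intro x hx
  refine Metric.mem_closure_iff.2 fun ε hε => ?_
  obtain ⟨p, hp₁, hp₂⟩ := exists_rat_btwn (show x - ε < x by linarith)
  obtain ⟨q, hq₁, hq₂⟩ := exists_rat_btwn (show x < x + ε by linarith)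
  obtain ⟨n, hn⟩ := he (p, q)
  have hI : I n = Set.Ioo (p : ℝ) (q : ℝ) := by simp only [I, hn]
  have hmem : a n ∈ I n := (ha n).2 ⟨x, hx, hI ▸ ⟨hp₂, hq₁⟩⟩
  rw [hI] at hmem
  refine ⟨a n, Set.mem_range_self n, ?_⟩
  rw [Real.dist_eq, abs_sub_lt_iff]
  constructor <;> linarith [hmem.1, hmem.2]
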